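/- Let Q be a finite group possessing subgroups P₁, P₂ that are ℤ-equivalent but not conjugate in Q. Then for every natural number m, the direct product Q^m contains a family of 2^m subgroups that are pairwise non-conjugate in Q^m and pairwise ℤ-equivalent; namely, for each z ∈ {1,2}^m the subgroup P_z = ∏_{i=1}^m P_{z(i)}, and these subgroups are pairwise non-conjugate and pairwise ℤ-equivalent as z ranges over {1,2}^m. -/

import Mathlib

/-- Subgroups `P₁, P₂ ≤ G` are `ℤ`-equivalent if the permutation modules `ℤ[G/P₁]` and
`ℤ[G/P₂]` are isomorphic as `ℤ[G]`-modules. -/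
def Subgroup.IsZEquiv {G : Type} [Group G] (P₁ P₂ : Subgroup G) : Prop :=
  Nonempty ((Representation.ofMulAction ℤ G (G ⧸ P₁)).asModule ≃ₗ[MonoidAlgebra ℤ G]
    (Representation.ofMulAction ℤ G (G ⧸ P₂)).asModule)

/-- Subgroups `A, B ≤ G` are conjugate if there is `g ∈ G` with `g⁻¹ A g = B`. -/
def Subgroup.IsConjugate {G : Type} [Group G] (A B : Subgroup G) : Prop :=
  ∃ g : G, (fun a => g⁻¹ * a * g) '' (A : Set G) = (B : Set G)

namespace Subgroup

section ZEquiv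

variable {G : Type} [Group G]

theorem IsZEquiv.refl (P : Subgroup G) : P.IsZEquiv P :=
  ⟨LinearEquiv.refl _ _⟩

theorem IsZEquiv.symm {P₁ P₂ : Subgroup G} (h : P₁.IsZEquiv P₂) : P₂.IsZEquiv P₁ :=
  h.map LinearEquiv.symm

/-- The standard basis of the free module on `X` underlying a permutation module. -/
noncomputable def permBasis (X : Type) : Module.Basis X ℤ (MonoidAlgebra ℤ X) :=
  .ofRepr (MonoidAlgebra.coeffLinearEquiv ℤ)

theorem permBasis_repr_apply {X : Type} (v : MonoidAlgebra ℤ X) (x : X) :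
    (permBasis X).repr v x = v.coeff x := rfl

theorem permBasis_apply {X : Type} (x : X) :
    permBasis X x = MonoidAlgebra.single x 1 := rfl

/-- Subgroups are `ℤ`-equivalent exactly when there is a `G`-invariant integral matrix, indexed by
their coset spaces, that is invertible over `ℤ`. -/
theorem isZEquiv_iff_exists_matrix (P₁ P₂ : Subgroup G) [Fintype (G ⧸ P₁)] [Fintype (G ⧸ P₂)]
    [DecidableEq (G ⧸ P₁)] [DecidableEq (G ⧸ P₂)] :
    P₁.IsZEquiv P₂ ↔ ∃ (M : Matrix (G ⧸ P₂) (G ⧸ P₁) ℤ) (N : Matrix (G ⧸ P₁) (G ⧸ P₂) ℤ),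
      (∀ (g : G) y x, M (g • y) (g • x) = M y x) ∧ M * N = 1 ∧ N * M = 1 := by
  let b₁ := permBasis (G ⧸ P₁)
  let b₂ := permBasis (G ⧸ P₂)
  let ρ₁ := Representation.ofMulAction ℤ G (G ⧸ P₁)
  let ρ₂ := Representation.ofMulAction ℤ G (G ⧸ P₂)
  constructor
  · rintro ⟨e⟩
    let φ := (Representation.IntertwiningMap.equivLinearMapAsModule ρ₁ ρ₂).symm e.toLinearMap
    let ψ := (Representation.IntertwiningMap.equivLinearMapAsModule ρ₂ ρ₁).symm e.symm.toLinearMap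
    refine ⟨φ.toLinearMap.toMatrix b₁ b₂, ψ.toLinearMap.toMatrix b₂ b₁, fun g y x => ?_, ?_, ?_⟩
    · have h := Representation.IntertwiningMap.isIntertwining ρ₁ ρ₂ φ g (MonoidAlgebra.single x 1)
      simp only [LinearMap.toMatrix_apply, b₁, b₂, permBasis_repr_apply, permBasis_apply]
      rw [← Representation.ofMulAction_single]
      refine (congrArg (fun v => v.coeff (g • y)) h).trans ?_
      simp [ρ₂, Representation.coeff_ofMulAction]
    · rw [← LinearMap.toMatrix_comp, ← LinearMap.toMatrix_id b₂]
      congr 1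
      exact LinearMap.ext fun v => e.apply_symm_apply v
    · rw [← LinearMap.toMatrix_comp, ← LinearMap.toMatrix_id b₁]
      congr 1
      exact LinearMap.ext fun v => e.symm_apply_apply v
  · rintro ⟨M, N, hM, hMN, hNM⟩
    let f := Matrix.toLin b₁ b₂ M
    have hf (g : G) : f ∘ₗ ρ₁ g = ρ₂ g ∘ₗ f := by
      refine b₁.ext fun x => ?_
      refine MonoidAlgebra.ext <| Finsupp.ext fun y => ?_
      have key (x y) : (f (MonoidAlgebra.single x 1)).coeff y = M y x := by
        have h := LinearMap.toMatrix_apply b₁ b₂ f y x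
        rw [LinearMap.toMatrix_toLin] at h
        exact h.symm
      simp only [LinearMap.comp_apply, b₁, permBasis_apply, ρ₁, ρ₂,
        Representation.ofMulAction_single, Representation.coeff_ofMulAction, key]
      rw [← hM g (g⁻¹ • y) x, smul_inv_smul]
    refine ⟨LinearEquiv.ofBijective
      (Representation.IntertwiningMap.equivLinearMapAsModule ρ₁ ρ₂ ⟨f, hf⟩) ?_⟩
    refine Function.bijective_iff_has_inverse.2 ⟨Matrix.toLin b₂ b₁ N, fun v => ?_, fun v => ?_⟩
    · change (Matrix.toLin b₂ b₁ N ∘ₗ f) v = v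
      rw [← Matrix.toLin_mul, hNM, Matrix.toLin_one]; rfl
    · change (f ∘ₗ Matrix.toLin b₂ b₁ N) v = v
      rw [← Matrix.toLin_mul, hMN, Matrix.toLin_one]; rfl

end ZEquiv

section Pi

variable {ι : Type} {G : ι → Type} [∀ i, Group (G i)]

/-- The coset space of a product of subgroups is the product of the coset spaces. -/
noncomputable def quotientPiEquiv (A : ∀ i, Subgroup (G i)) :
    ((∀ i, G i) ⧸ Subgroup.pi Set.univ A) ≃ ∀ i, G i ⧸ A i :=
  .ofBijective
    (fun q i => Quotient.map' (fun x : ∀ i, G i => x i)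
      (fun x y h => by
        rw [QuotientGroup.leftRel_apply] at h ⊢
        exact h i trivial) q) <| by
    constructor
    · intro p q h
      induction p using QuotientGroup.induction_on with | H x =>
      induction q using QuotientGroup.induction_on with | H y =>
      exact QuotientGroup.eq.2 fun i _ => QuotientGroup.eq.1 (congrFun h i)
    · intro q
      exact ⟨QuotientGroup.mk fun i => (q i).out, funext fun i => Quotient.out_eq' (q i)⟩

theorem quotientPiEquiv_smul (A : ∀ i, Subgroup (G i)) (g : ∀ i, G i)
    (q : (∀ i, G i) ⧸ Subgroup.pi Set.univ A) (i : ι) :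
    quotientPiEquiv A (g • q) i = g i • quotientPiEquiv A q i := by
  induction q using QuotientGroup.induction_on with | H x => rfl

/-- The Kronecker product of a family of matrices indexed by coset spaces. -/
noncomputable def kroneckerPi [Fintype ι] (A B : ∀ i, Subgroup (G i))
    (M : ∀ i, Matrix (G i ⧸ A i) (G i ⧸ B i) ℤ) :
    Matrix ((∀ i, G i) ⧸ Subgroup.pi Set.univ A) ((∀ i, G i) ⧸ Subgroup.pi Set.univ B) ℤ :=
  fun p q => ∏ i, M i (quotientPiEquiv A p i) (quotientPiEquiv B q i)

open Classical in
theorem kroneckerPi_mul_eq_one [Fintype ι] {A B : ∀ i, Subgroup (G i)}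
    [∀ i, Fintype (G i ⧸ B i)] [Fintype ((∀ i, G i) ⧸ Subgroup.pi Set.univ B)]
    {M : ∀ i, Matrix (G i ⧸ A i) (G i ⧸ B i) ℤ} {N : ∀ i, Matrix (G i ⧸ B i) (G i ⧸ A i) ℤ}
    (h : ∀ i, M i * N i = 1) : kroneckerPi A B M * kroneckerPi B A N = 1 := by
  ext p r
  calc (kroneckerPi A B M * kroneckerPi B A N) p r
      = ∑ q : ∀ i, G i ⧸ B i, ∏ i, M i (quotientPiEquiv A p i) (q i) *
          N i (q i) (quotientPiEquiv A r i) := by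
        simp only [Matrix.mul_apply, kroneckerPi, ← Finset.prod_mul_distrib]
        exact Equiv.sum_comp (quotientPiEquiv B) fun q => ∏ i,
          M i (quotientPiEquiv A p i) (q i) * N i (q i) (quotientPiEquiv A r i)
    _ = ∏ i, (M i * N i) (quotientPiEquiv A p i) (quotientPiEquiv A r i) := by
        simp only [Matrix.mul_apply, Finset.prod_univ_sum, Fintype.piFinset_univ]
    _ = (1 : Matrix _ _ ℤ) p r := by
        simp only [h, Matrix.one_apply, Fintype.prod_boole, ← funext_iff,
          (quotientPiEquiv A).injective.eq_iff]

theorem IsZEquiv.pi [Finite ι] [∀ i, Finite (G i)] {A B : ∀ i, Subgroup (G i)}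
    (h : ∀ i, (A i).IsZEquiv (B i)) :
    (Subgroup.pi Set.univ A).IsZEquiv (Subgroup.pi Set.univ B) := by
  classical
  have := Fintype.ofFinite ι
  have (i : ι) := Fintype.ofFinite (G i ⧸ A i)
  have (i : ι) := Fintype.ofFinite (G i ⧸ B i)
  have := Fintype.ofFinite ((∀ i, G i) ⧸ Subgroup.pi Set.univ A)
  have := Fintype.ofFinite ((∀ i, G i) ⧸ Subgroup.pi Set.univ B)
  choose M N hM hMN hNM using fun i => (isZEquiv_iff_exists_matrix (A i) (B i)).1 (h i)
  refine (isZEquiv_iff_exists_matrix _ _).2 ⟨kroneckerPi B A M, kroneckerPi A B N,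
    fun g p q => ?_, ?_, ?_⟩
  · simp only [kroneckerPi, quotientPiEquiv_smul, hM]
  · convert kroneckerPi_mul_eq_one hMN
  · convert kroneckerPi_mul_eq_one hNM

theorem IsConjugate.of_pi {ι Q : Type} [Group Q] {A B : ι → Subgroup Q}
    (h : IsConjugate (G := ι → Q) (Subgroup.pi Set.univ A) (Subgroup.pi Set.univ B)) (i : ι) :
    (A i).IsConjugate (B i) := by
  classical
  obtain ⟨g, hg⟩ := h
  refine ⟨g i, Set.Subset.antisymm ?_ fun b hb => ?_⟩
  · rintro _ ⟨a, ha, rfl⟩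
    have hmem : Pi.mulSingle i a ∈ Subgroup.pi Set.univ A := by
      rw [Subgroup.mulSingle_mem_pi]
      exact fun _ => ha
    have := hg.subset ⟨_, hmem, rfl⟩ i trivial
    simpa using this
  · have hmem : Pi.mulSingle i b ∈ Subgroup.pi Set.univ B := by
      rw [Subgroup.mulSingle_mem_pi]
      exact fun _ => hb
    obtain ⟨a, ha, hab⟩ := hg.superset hmem
    exact ⟨a i, ha i trivial, by simpa using congrFun hab i⟩

end Pi

section Conjugate

variable {G : Type} [Group G]

theorem IsConjugate.refl (A : Subgroup G) : A.IsConjugate A :=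
  ⟨1, by simp⟩

theorem IsConjugate.symm {A B : Subgroup G} (h : A.IsConjugate B) : B.IsConjugate A := by
  obtain ⟨g, hg⟩ := h
  refine ⟨g⁻¹, ?_⟩
  rw [← hg, Set.image_image]
  simp [mul_assoc]

end Conjugate

end Subgroup

/-- Let `Q` be a finite group with subgroups `P₁, P₂` that are `ℤ`-equivalent but not
conjugate in `Q`.  Then for every `m`, the direct product `Q^m` contains a family of `2^m`
subgroups, namely `P_z = ∏ᵢ P_{z i}` for `z ∈ {1,2}^m`, which are pairwise `ℤ`-equivalent
and pairwise non-conjugate in `Q^m`. -/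
theorem prod_family_isZEquiv_not_conjugate {Q : Type} [Group Q] [Finite Q]
    (P₁ P₂ : Subgroup Q) (hequiv : Subgroup.IsZEquiv P₁ P₂)
    (hconj : ¬ P₁.IsConjugate P₂) (m : ℕ) :
    Nat.card (Set.range fun z : Fin m → Fin 2 =>
        Subgroup.pi Set.univ fun i => ![P₁, P₂] (z i)) = 2 ^ m ∧
    (∀ z z' : Fin m → Fin 2,
      Subgroup.IsZEquiv (G := Fin m → Q)
        (Subgroup.pi Set.univ fun i => ![P₁, P₂] (z i))
        (Subgroup.pi Set.univ fun i => ![P₁, P₂] (z' i))) ∧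
    (∀ z z' : Fin m → Fin 2, z ≠ z' →
      ¬ Subgroup.IsConjugate (G := Fin m → Q)
        (Subgroup.pi Set.univ fun i => ![P₁, P₂] (z i))
        (Subgroup.pi Set.univ fun i => ![P₁, P₂] (z' i))) := by
  have hnc : ∀ z z' : Fin m → Fin 2, z ≠ z' →
      ¬ Subgroup.IsConjugate (G := Fin m → Q)
        (Subgroup.pi Set.univ fun i => ![P₁, P₂] (z i))
        (Subgroup.pi Set.univ fun i => ![P₁, P₂] (z' i)) := by
    intro z z' hne h
    obtain ⟨i, hi⟩ := Function.ne_iff.1 hne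
    have hc : (![P₁, P₂] (z i)).IsConjugate (![P₁, P₂] (z' i)) := h.of_pi i
    revert hi hc
    generalize z i = a
    generalize z' i = b
    fin_cases a <;> fin_cases b <;> intro hi hc
    · exact hi rfl
    · exact hconj hc
    · exact hconj hc.symm
    · exact hi rfl
  refine ⟨?_, fun z z' => Subgroup.IsZEquiv.pi fun i => ?_, hnc⟩
  · rw [Nat.card_range_of_injective]
    · simp
    · intro z z' h
      by_contra hne
      refine hnc z z' hne ?_
      rw [show Subgroup.pi Set.univ (fun i => ![P₁, P₂] (z i)) =
        Subgroup.pi Set.univ fun i => ![P₁, P₂] (z' i) from h]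
      exact .refl _
  · generalize z i = a
    generalize z' i = b
    fin_cases a <;> fin_cases b
    · exact .refl _
    · exact hequiv
    · exact hequiv.symm
    · exact .refl _
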